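/- Let h : ℝ → ℝ be continuous, 2π-periodic and positive, and let gₙ ∈ BV_♯(ℝ) be a sequence such that the Hausdorff distance d_ℋ(Γ_{gₙ} ∪ Σ_{gₙ}, Γ_h) converges to 0 as n → ∞. Then sup_ℝ |gₙ − h| → 0 as n → ∞. -/

import Mathlib

open Real MeasureTheory Filter Set Metric

noncomputable section

/-- The point on the unit circle at angle `θ`, as an element of the Euclidean plane. -/
def sig (θ : ℝ) : EuclideanSpace ℝ (Fin 2) :=
  (EuclideanSpace.equiv (Fin 2) ℝ).symm ![Real.cos θ, Real.sin θ]

/-- `g ∈ BV_♯(ℝ)`: upper semicontinuous, `2π`-periodic, with values in `[0, R₀]` and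
finite pointwise total variation on `[0, 2π]`. -/
def BVsharp (R₀ : ℝ) (g : ℝ → ℝ) : Prop :=
  UpperSemicontinuous g ∧ Function.Periodic g (2 * Real.pi) ∧
    (∀ θ, 0 ≤ g θ ∧ g θ ≤ R₀) ∧ BoundedVariationOn g (Set.Icc 0 (2 * Real.pi))

/-- `g⁻(θ) = liminf_{θ' → θ} g(θ')`. -/
def gminus (g : ℝ → ℝ) (θ : ℝ) : ℝ := Filter.liminf g (nhdsWithin θ {θ}ᶜ)

/-- `g⁺(θ) = limsup_{θ' → θ} g(θ')`. -/
def gplus (g : ℝ → ℝ) (θ : ℝ) : ℝ := Filter.limsup g (nhdsWithin θ {θ}ᶜ)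

/-- The "regular" part `Γ_g` of the extended graph of `g`. -/
def GammaSet (g : ℝ → ℝ) : Set (EuclideanSpace ℝ (Fin 2)) :=
  {p | ∃ θ ρ : ℝ, gminus g θ ≤ ρ ∧ ρ ≤ gplus g θ ∧ p = ρ • sig θ}

/-- The set of cracks `Σ_g`. -/
def SigmaSet (g : ℝ → ℝ) : Set (EuclideanSpace ℝ (Fin 2)) :=
  closure {p | ∃ θ ρ : ℝ, gplus g θ < ρ ∧ ρ < g θ ∧ p = ρ • sig θ}

lemma norm_sig (θ : ℝ) : ‖sig θ‖ = 1 := by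
  simp [sig, EuclideanSpace.norm_eq, Fin.sum_univ_two]

lemma norm_sig_sub_sig (a b : ℝ) : ‖sig a - sig b‖ = 2 * |sin ((a - b) / 2)| := by
  have key : ‖sig a - sig b‖ ^ 2 = (2 * |sin ((a - b) / 2)|) ^ 2 := by
    rw [EuclideanSpace.norm_sq_eq, Fin.sum_univ_two, mul_pow, sq_abs, Real.sin_sq_eq_half_sub,
      mul_div_cancel₀ _ (two_ne_zero' ℝ), Real.cos_sub]
    simp only [sig, EuclideanSpace.equiv, PiLp.sub_apply, PiLp.coe_symm_continuousLinearEquiv,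
      Matrix.cons_val_zero, Matrix.cons_val_one, Real.norm_eq_abs, sq_abs]
    linarith [Real.sin_sq_add_cos_sq a, Real.sin_sq_add_cos_sq b]
  exact (pow_left_inj₀ (norm_nonneg _) (by positivity) two_ne_zero).1 key

/-- Modulo `2π`, the angular distance is controlled by the chordal distance. -/
lemma exists_int_abs_sub_le (a b : ℝ) :
    ∃ k : ℤ, |a - k * (2 * π) - b| ≤ π / 2 * ‖sig a - sig b‖ := by
  refine ⟨round ((a - b) / (2 * π)), ?_⟩
  set k := round ((a - b) / (2 * π))
  have hpi := Real.pi_pos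
  set y := a - k * (2 * π) - b with hy
  have h1 : |y| ≤ π := by
    have h2 : y = ((a - b) / (2 * π) - k) * (2 * π) := by
      rw [sub_mul, div_mul_cancel₀ _ (by positivity), hy]
      ring
    rw [h2, abs_mul, abs_of_pos (by positivity : 0 < 2 * π)]
    nlinarith [abs_sub_round ((a - b) / (2 * π))]
  have h3 : |sin (y / 2)| = |sin ((a - b) / 2)| := by
    rw [show y / 2 = (a - b) / 2 - k * π by rw [hy]; ring, Real.sin_sub_int_mul_pi, abs_mul,
      abs_zpow, abs_neg, abs_one, one_zpow, one_mul]
  have h4 : 2 / π * |y / 2| ≤ |sin (y / 2)| := by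
    refine Real.mul_abs_le_abs_sin ?_
    rw [abs_div, abs_two]
    linarith
  rw [abs_div, abs_two, h3] at h4
  rw [norm_sig_sub_sig]
  calc |y| = π * (2 / π * (|y| / 2)) := by field_simp
    _ ≤ π * |sin ((a - b) / 2)| := by gcongr
    _ = _ := by ring

lemma Function.Periodic.uniformContinuous {f : ℝ → ℝ} (hp : Function.Periodic f (2 * π))
    (hf : Continuous f) : UniformContinuous f := by
  have : Fact (0 < 2 * π) := ⟨Real.two_pi_pos⟩
  have h1 : Continuous (hp.lift : AddCircle (2 * π) → ℝ) := continuous_coinduced_dom.2 hf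
  have h2 : UniformContinuous (fun x : ℝ => (x : AddCircle (2 * π))) :=
    uniformContinuous_addMonoidHom_of_continuous
      (f := QuotientAddGroup.mk' (AddSubgroup.zmultiples (2 * π)))
      (AddCircle.continuous_mk' (2 * π))
  exact (CompactSpace.uniformContinuous_of_continuous h1).comp h2

lemma gminus_eq_of_continuous {h : ℝ → ℝ} (hc : Continuous h) (θ : ℝ) : gminus h θ = h θ :=
  (hc.continuousAt.tendsto.mono_left nhdsWithin_le_nhds).liminf_eq

lemma gplus_eq_of_continuous {h : ℝ → ℝ} (hc : Continuous h) (θ : ℝ) : gplus h θ = h θ :=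
  (hc.continuousAt.tendsto.mono_left nhdsWithin_le_nhds).limsup_eq

lemma GammaSet_eq_range {h : ℝ → ℝ} (hc : Continuous h) :
    GammaSet h = range fun θ => h θ • sig θ := by
  ext p
  simp only [GammaSet, gminus_eq_of_continuous hc, gplus_eq_of_continuous hc, mem_ofPred_eq,
    mem_range]
  constructor
  · rintro ⟨θ, ρ, h1, h2, rfl⟩
    exact ⟨θ, by rw [le_antisymm h1 h2]⟩
  · rintro ⟨θ, rfl⟩
    exact ⟨θ, h θ, le_rfl, le_rfl, rfl⟩

lemma isBounded_of_forall_smul_sig {s : Set (EuclideanSpace ℝ (Fin 2))} {C : ℝ}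
    (hs : ∀ p ∈ s, ∃ θ ρ : ℝ, 0 ≤ ρ ∧ ρ ≤ C ∧ p = ρ • sig θ) : Bornology.IsBounded s := by
  refine isBounded_iff_forall_norm_le.2 ⟨C, fun p hp => ?_⟩
  obtain ⟨θ, ρ, h0, h1, rfl⟩ := hs p hp
  rwa [norm_smul, norm_sig, mul_one, Real.norm_of_nonneg h0]

section BVsharp

variable {R₀ : ℝ} {g : ℝ → ℝ}

lemma BVsharp.isBoundedUnder_le (hg : BVsharp R₀ g) (l : Filter ℝ) :
    l.IsBoundedUnder (· ≤ ·) g :=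
  isBoundedUnder_of ⟨R₀, fun θ => (hg.2.2.1 θ).2⟩

lemma BVsharp.isBoundedUnder_ge (hg : BVsharp R₀ g) (l : Filter ℝ) :
    l.IsBoundedUnder (· ≥ ·) g :=
  isBoundedUnder_of ⟨0, fun θ => (hg.2.2.1 θ).1⟩

lemma BVsharp.gminus_nonneg (hg : BVsharp R₀ g) (θ : ℝ) : 0 ≤ gminus g θ :=
  le_liminf_of_le (hg.isBoundedUnder_le _).isCoboundedUnder_ge
    (Eventually.of_forall fun θ' => (hg.2.2.1 θ').1)

lemma BVsharp.gplus_le (hg : BVsharp R₀ g) (θ : ℝ) : gplus g θ ≤ R₀ :=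
  limsup_le_of_le (hg.isBoundedUnder_ge _).isCoboundedUnder_le
    (Eventually.of_forall fun θ' => (hg.2.2.1 θ').2)

lemma BVsharp.gminus_le_gplus (hg : BVsharp R₀ g) (θ : ℝ) : gminus g θ ≤ gplus g θ :=
  liminf_le_limsup (hg.isBoundedUnder_le _) (hg.isBoundedUnder_ge _)

lemma BVsharp.gplus_le_self (hg : BVsharp R₀ g) (θ : ℝ) : gplus g θ ≤ g θ := by
  refine le_of_forall_gt fun y hy => ?_
  obtain ⟨z, hz, hzy⟩ := exists_between hy
  refine lt_of_le_of_lt (limsup_le_of_le (hg.isBoundedUnder_ge _).isCoboundedUnder_le ?_) hzy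
  filter_upwards [nhdsWithin_le_nhds (hg.1 θ z hz)] with θ' hθ' using hθ'.le

lemma BVsharp.isBounded_GammaSet_union_SigmaSet (hg : BVsharp R₀ g) :
    Bornology.IsBounded (GammaSet g ∪ SigmaSet g) := by
  refine Bornology.IsBounded.union (isBounded_of_forall_smul_sig (C := R₀) ?_)
    (Bornology.IsBounded.closure (isBounded_of_forall_smul_sig (C := R₀) ?_))
  · rintro p ⟨θ, ρ, h1, h2, rfl⟩
    exact ⟨θ, ρ, (hg.gminus_nonneg θ).trans h1, h2.trans (hg.gplus_le θ), rfl⟩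
  · rintro p ⟨θ, ρ, h1, h2, rfl⟩
    exact ⟨θ, ρ, ((hg.gminus_nonneg θ).trans (hg.gminus_le_gplus θ)).trans h1.le,
      h2.le.trans (hg.2.2.1 θ).2, rfl⟩

lemma BVsharp.smul_sig_mem (hg : BVsharp R₀ g) (θ : ℝ) :
    g θ • sig θ ∈ GammaSet g ∪ SigmaSet g := by
  rcases (hg.gplus_le_self θ).eq_or_lt with h | h
  · exact Or.inl ⟨θ, g θ, h ▸ hg.gminus_le_gplus θ, h.ge, rfl⟩
  · refine Or.inr ?_
    have hcont : Continuous fun ρ : ℝ => ρ • sig θ := by fun_prop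
    have hmem : g θ ∈ closure (Ioo (gplus g θ) (g θ)) := by
      rw [closure_Ioo h.ne]
      exact right_mem_Icc.2 h.le
    refine closure_mono ?_ (image_closure_subset_closure_image hcont (mem_image_of_mem _ hmem))
    rintro _ ⟨ρ, ⟨h1, h2⟩, rfl⟩
    exact ⟨θ, ρ, h1, h2, rfl⟩

end BVsharp

/-- A point close to the graph of a positive continuous periodic radial function `h` has a modulus
close to the value of `h` at its own angle. -/
lemma exists_forall_dist_smul_sig_lt {h : ℝ → ℝ} (hcont : Continuous h)
    (hper : Function.Periodic h (2 * π)) (hpos : ∀ θ, 0 < h θ) {ε : ℝ} (hε : 0 < ε) :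
    ∃ η > 0, ∀ r θ θ' : ℝ, 0 ≤ r → dist (r • sig θ) (h θ' • sig θ') < η → |r - h θ| ≤ ε := by
  obtain ⟨m, hm, hmle⟩ : ∃ m > 0, ∀ θ, m ≤ h θ := by
    obtain ⟨_, ⟨θ₀, rfl⟩, h0⟩ := (hper.compact_of_continuous Real.two_pi_pos.ne'
      hcont).exists_isLeast (range_nonempty h)
    exact ⟨h θ₀, hpos θ₀, fun θ => h0 (mem_range_self θ)⟩
  obtain ⟨δ, hδ, hunif⟩ := Metric.uniformContinuous_iff.1 (hper.uniformContinuous hcont)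
    (ε / 2) (half_pos hε)
  have hpi := Real.pi_pos
  refine ⟨min (ε / 2) (m * δ / π), by positivity, fun r θ θ' hr hd => ?_⟩
  have hd1 := hd.trans_le (min_le_left _ _)
  have hd2 := hd.trans_le (min_le_right _ _)
  rw [lt_div_iff₀ hpi] at hd2
  rw [dist_eq_norm] at hd1 hd2
  set D := ‖r • sig θ - h θ' • sig θ'‖
  have hrad : |r - h θ'| ≤ D := by
    have := abs_norm_sub_norm_le (r • sig θ) (h θ' • sig θ')
    rwa [norm_smul, norm_smul, norm_sig, norm_sig, mul_one, mul_one, Real.norm_of_nonneg hr,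
      Real.norm_of_nonneg (hpos θ').le] at this
  have hchord : h θ' * ‖sig θ - sig θ'‖ ≤ 2 * D := by
    have heq : h θ' • (sig θ - sig θ') =
        (r • sig θ - h θ' • sig θ') - (r - h θ') • sig θ := by module
    calc h θ' * ‖sig θ - sig θ'‖ = ‖h θ' • (sig θ - sig θ')‖ := by
          rw [norm_smul, Real.norm_of_nonneg (hpos θ').le]
      _ ≤ D + ‖(r - h θ') • sig θ‖ := heq ▸ norm_sub_le _ _
      _ ≤ 2 * D := by
          rw [norm_smul, norm_sig, mul_one, Real.norm_eq_abs]
          linarith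
  have hchord' : m * ‖sig θ - sig θ'‖ ≤ 2 * D :=
    (mul_le_mul_of_nonneg_right (hmle θ') (norm_nonneg _)).trans hchord
  obtain ⟨k, hk⟩ := exists_int_abs_sub_le θ θ'
  have hang : |θ - k * (2 * π) - θ'| < δ := by
    refine hk.trans_lt (lt_of_mul_lt_mul_left ?_ hm.le)
    nlinarith
  have hclose := hunif (a := θ - k * (2 * π)) (b := θ') (by rwa [Real.dist_eq])
  rw [hper.sub_int_mul_eq k, Real.dist_eq, abs_sub_comm] at hclose
  linarith [abs_sub_le r (h θ') (h θ)]

theorem stmt1 (R₀ : ℝ) (hR₀ : 0 < R₀) (h : ℝ → ℝ)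
    (hcont : Continuous h) (hper : Function.Periodic h (2 * Real.pi))
    (hpos : ∀ θ, 0 < h θ)
    (g : ℕ → ℝ → ℝ) (hg : ∀ n, BVsharp R₀ (g n))
    (hH : Tendsto
      (fun n => Metric.hausdorffDist (GammaSet (g n) ∪ SigmaSet (g n)) (GammaSet h))
      atTop (nhds 0)) :
    ∀ ε > 0, ∃ N : ℕ, ∀ n ≥ N, ∀ θ, |g n θ - h θ| ≤ ε := by
  intro ε hε
  obtain ⟨η, hη, hclose⟩ := exists_forall_dist_smul_sig_lt hcont hper hpos hε
  obtain ⟨N, hN⟩ := eventually_atTop.1 (hH.eventually_lt_const hη)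
  refine ⟨N, fun n hn θ => ?_⟩
  have hbdd : Bornology.IsBounded (GammaSet h) := by
    obtain ⟨C, hC⟩ := (hper.compact_of_continuous Real.two_pi_pos.ne' hcont).bddAbove
    rw [GammaSet_eq_range hcont]
    refine isBounded_of_forall_smul_sig (C := C) ?_
    rintro _ ⟨φ, rfl⟩
    exact ⟨φ, h φ, (hpos φ).le, hC (mem_range_self φ), rfl⟩
  have hne : (GammaSet h).Nonempty := GammaSet_eq_range hcont ▸ range_nonempty _
  have hmem := (hg n).smul_sig_mem θ
  obtain ⟨y, hy, hdist⟩ := exists_dist_lt_of_hausdorffDist_lt hmem (hN n hn)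
    (hausdorffEDist_ne_top_of_nonempty_of_bounded ⟨_, hmem⟩ hne
      (hg n).isBounded_GammaSet_union_SigmaSet hbdd)
  rw [GammaSet_eq_range hcont] at hy
  obtain ⟨θ', rfl⟩ := hy
  exact hclose _ θ θ' ((hg n).2.2.1 θ).1 hdist

end
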